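/- Let V be a finite type and C a finite set of pairwise constraints on V. Then there exists a labeling ℓ : V → ℕ consistent with C if and only if C contains no closed walk of weight exactly 1 (i.e., no closed walk traversing exactly one cannot-link constraint and otherwise only must-link constraints). (Characterization of conflict-free (satisfiable) constraint graphs.) -/

import Mathlib

/-- A pairwise constraint is a triple `(x, y, θ)`; `θ = false` is a must-link,
`θ = true` is a cannot-link. A labeling `ℓ` satisfies it accordingly. -/
def Satisfies {V : Type*} (ℓ : V → ℕ) (c : V × V × Bool) : Prop :=
  if c.2.2 = true then ℓ c.1 ≠ ℓ c.2.1 else ℓ c.1 = ℓ c.2.1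

/-- `ℓ` is consistent with the constraint graph `C`. -/
def Consistent {V : Type*} (ℓ : V → ℕ) (C : Finset (V × V × Bool)) : Prop :=
  ∀ c ∈ C, Satisfies ℓ c

/-- `p 0 = x, …, p m = y` is a walk from `x` to `y` in `C`, where the `i`-th step
traverses a constraint of type `θ i` present in `C` in either direction. -/
def IsWalk {V : Type*} (C : Finset (V × V × Bool)) (x y : V) (m : ℕ)
    (p : ℕ → V) (θ : ℕ → Bool) : Prop :=
  p 0 = x ∧ p m = y ∧ ∀ i < m, (p i, p (i + 1), θ i) ∈ C ∨ (p (i + 1), p i, θ i) ∈ C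

/-- The weight of a walk: the number of cannot-link constraints traversed. -/
def walkWeight (m : ℕ) (θ : ℕ → Bool) : ℕ :=
  ∑ i ∈ Finset.range m, if θ i then 1 else 0

theorem walkWeight_succ (m : ℕ) (θ : ℕ → Bool) :
    walkWeight (m + 1) θ = walkWeight m θ + if θ m then 1 else 0 :=
  Finset.sum_range_succ _ m

/-- Along a walk, a consistent labeling is constant if the weight is `0`, and takes different
values at the endpoints if the weight is `1`. -/
theorem Consistent.eq_and_ne_of_isWalk {V : Type*} {ℓ : V → ℕ} {C : Finset (V × V × Bool)}
    (hℓ : Consistent ℓ C) {x y : V} {m : ℕ} {p : ℕ → V} {θ : ℕ → Bool}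
    (hp : IsWalk C x y m p θ) :
    (walkWeight m θ = 0 → ℓ x = ℓ y) ∧ (walkWeight m θ = 1 → ℓ x ≠ ℓ y) := by
  induction m generalizing y with
  | zero =>
    obtain ⟨rfl, rfl, -⟩ := hp
    simp [walkWeight]
  | succ m ih =>
    obtain ⟨h0, rfl, hs⟩ := hp
    obtain ⟨ih0, ih1⟩ := ih ⟨h0, rfl, fun i hi => hs i (by omega)⟩
    have hstep : if θ m then ℓ (p m) ≠ ℓ (p (m + 1)) else ℓ (p m) = ℓ (p (m + 1)) := by
      rcases hs m (by omega) with h | h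
      · exact hℓ _ h
      · simpa only [Satisfies, eq_comm, ne_comm] using hℓ _ h
    rw [walkWeight_succ]
    cases hθ : θ m <;> simp_all

theorem IsWalk.exists_snoc {V : Type*} {C : Finset (V × V × Bool)} {x y z : V} {m : ℕ}
    {p : ℕ → V} {θ : ℕ → Bool} (hp : IsWalk C x y m p θ) {b : Bool}
    (h : (y, z, b) ∈ C ∨ (z, y, b) ∈ C) :
    ∃ (q : ℕ → V) (η : ℕ → Bool), IsWalk C x z (m + 1) q η ∧
      walkWeight (m + 1) η = walkWeight m θ + if b then 1 else 0 := by
  obtain ⟨rfl, rfl, hs⟩ := hp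
  refine ⟨fun i => if i ≤ m then p i else z, fun i => if i < m then θ i else b,
    ⟨by simp, by simp, fun i hi => ?_⟩, ?_⟩
  · rcases (Nat.lt_succ_iff_lt_or_eq.mp hi) with hi | rfl
    · simpa [hi, hi.le, Nat.succ_le_of_lt hi] using hs i hi
    · simpa using h
  · rw [walkWeight_succ]
    congr 1
    · exact Finset.sum_congr rfl fun i hi => by simp [Finset.mem_range.mp hi]
    · simp

/-- `a` and `b` are joined by a must-link constraint, in either direction. -/
def MustLink {V : Type*} (C : Finset (V × V × Bool)) (a b : V) : Prop :=
  (a, b, false) ∈ C ∨ (b, a, false) ∈ C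

instance {V : Type*} (C : Finset (V × V × Bool)) : Std.Symm (MustLink C) where
  symm _ _ := Or.symm

theorem exists_isWalk_of_reflTransGen_mustLink {V : Type*} {C : Finset (V × V × Bool)} {x y : V}
    (h : Relation.ReflTransGen (MustLink C) x y) :
    ∃ (m : ℕ) (p : ℕ → V) (θ : ℕ → Bool), IsWalk C x y m p θ ∧ walkWeight m θ = 0 := by
  induction h with
  | refl => exact ⟨0, fun _ => x, fun _ => false, ⟨rfl, rfl, by simp⟩, rfl⟩
  | tail _ hbc ih =>
    obtain ⟨m, p, θ, hp, hw⟩ := ih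
    obtain ⟨q, η, hq, hη⟩ := hp.exists_snoc hbc
    exact ⟨m + 1, q, η, hq, by simpa [hw] using hη⟩

/-- The connected components of the must-link constraints. -/
def mustLinkSetoid {V : Type*} (C : Finset (V × V × Bool)) : Setoid V where
  r := Relation.ReflTransGen (MustLink C)
  iseqv :=
    { refl := fun _ => .refl
      symm := fun h => symm_of (Relation.ReflTransGen (MustLink C)) h
      trans := fun h h' => h.trans h' }

/-- Characterization of conflict-free (satisfiable) constraint graphs: a consistent
labeling exists iff there is no closed walk of weight exactly 1. -/
theorem satisfiable_iff_no_closed_walk_weight1 {V : Type*} [Fintype V]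
    (C : Finset (V × V × Bool)) :
    (∃ ℓ : V → ℕ, Consistent ℓ C) ↔
      ¬ ∃ (x : V) (m : ℕ) (p : ℕ → V) (θ : ℕ → Bool),
          IsWalk C x x m p θ ∧ walkWeight m θ = 1 := by
  constructor
  · rintro ⟨ℓ, hℓ⟩ ⟨x, m, p, θ, hp, hw⟩
    exact (hℓ.eq_and_ne_of_isWalk hp).2 hw rfl
  · intro hC
    obtain ⟨f, hf⟩ := exists_injective_nat (Quotient (mustLinkSetoid C))
    refine ⟨fun v => f (Quotient.mk _ v), ?_⟩
    rintro ⟨x, y, b⟩ hc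
    cases b with
    | false =>
      have hxy : (mustLinkSetoid C).r x y := .single (Or.inl hc)
      simpa [Satisfies] using congrArg f (Quotient.sound hxy)
    | true =>
      simp only [Satisfies, if_true]
      intro heq
      have hyx : (mustLinkSetoid C).r y x := Quotient.exact (hf heq.symm)
      obtain ⟨m, p, θ, hp, hw⟩ := exists_isWalk_of_reflTransGen_mustLink hyx
      obtain ⟨q, η, hq, hη⟩ := hp.exists_snoc (Or.inl hc)
      exact hC ⟨y, m + 1, q, η, hq, by simpa [hw] using hη⟩
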